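/- arXiv:math/0308117 — 4 statements merged into one kernel-verified Lean document; each statement's English description precedes it below -/
import Mathlib

section
/- For all 1 ≤ k ≤ l ≤ n and all m, p ∈ ℤ, the normally ordered quadratic operators satisfy [N_{kl,m}, N_{kl,p}] = −δ_{l≤r} · m · δ_{m+p,0} · id as linear operators on ℂ[x], where δ_{l≤r} is 1 if l ≤ r and 0 otherwise. -/
open MvPolynomial

/-- Index type for the variables `x_{ij,m}`, `1 ≤ i ≤ j ≤ n`, `m ∈ ℤ`
(only the indices with `i ≤ j` are ever used). -/
abbrev XIdx (n : ℕ) := Fin n × Fin n × ℤ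

/-- The Fock space `ℂ[x]`. -/
abbrev Px (n : ℕ) := MvPolynomial (XIdx n) ℂ

/-- The oscillator operator `a_{ij,m}` on `ℂ[x]`:  `∂/∂x_{ij,m}` if `m ≥ 0` and `j ≤ r`,
multiplication by `x_{ij,m}` otherwise. -/
noncomputable def aOp (n r : ℕ) (i j : Fin n) (m : ℤ) : Module.End ℂ (Px n) :=
  if 0 ≤ m ∧ (j : ℕ) + 1 ≤ r then (pderiv (i, j, m)).toLinearMap
  else LinearMap.mulLeft ℂ (X (i, j, m))

/-- The oscillator operator `a*_{ij,m}` on `ℂ[x]`:  multiplication by `x_{ij,-m}` if `m ≤ 0`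
and `j ≤ r`, and `-∂/∂x_{ij,-m}` otherwise. -/
noncomputable def aStar (n r : ℕ) (i j : Fin n) (m : ℤ) : Module.End ℂ (Px n) :=
  if m ≤ 0 ∧ (j : ℕ) + 1 ≤ r then LinearMap.mulLeft ℂ (X (i, j, -m))
  else - (pderiv (i, j, -m)).toLinearMap

/-- The normally ordered quadratic operator `N_{kl,m} = Σ_{q∈ℤ} :a_{kl,q} a*_{kl,m-q}:`
(pointwise `finsum`; for each polynomial only finitely many summands are nonzero). -/
noncomputable def Nop (n r : ℕ) (k l : Fin n) (m : ℤ) (P : Px n) : Px n :=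
  ∑ᶠ q : ℤ,
    if 0 ≤ q ∧ (l : ℕ) + 1 ≤ r then aStar n r k l (m - q) (aOp n r k l q P)
    else aOp n r k l q (aStar n r k l (m - q) P)

section Oscillators

variable {n r : ℕ} {k l : Fin n}

/-- The normally ordered product `:a_{kl,q} a*_{kl,m-q}:`. -/
noncomputable def normalOrderedTerm (n r : ℕ) (k l : Fin n) (m q : ℤ) : Module.End ℂ (Px n) :=
  if 0 ≤ q ∧ (l : ℕ) + 1 ≤ r then aStar n r k l (m - q) * aOp n r k l q
  else aOp n r k l q * aStar n r k l (m - q)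

theorem finite_pderiv_ne_zero {σ ι R : Type*} [CommSemiring R] {f : ι → σ}
    (hf : Function.Injective f) (P : MvPolynomial σ R) :
    {i | pderiv (f i) P ≠ 0}.Finite := by
  refine (P.vars.finite_toSet.preimage hf.injOn).subset fun i hi => ?_
  by_contra h
  exact hi (pderiv_eq_zero_of_notMem_vars h)

theorem injective_mk_sub (k l : Fin n) (m : ℤ) :
    Function.Injective fun q : ℤ => ((k, l, q - m) : XIdx n) := fun a b h => by
  simpa using h

theorem pderiv_comm_apply {σ R : Type*} [CommSemiring R] (i j : σ) (P : MvPolynomial σ R) :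
    pderiv i (pderiv j P) = pderiv j (pderiv i P) := by
  classical
  ext s
  simp only [coeff_pderiv, Finsupp.add_apply, add_right_comm s]
  by_cases h : i = j
  · subst h; rfl
  · simp [h, Ne.symm h]
    ring

theorem eq_C_of_pderiv_eq_zero {σ R : Type*} [CommRing R] [IsDomain R] [CharZero R]
    {P : MvPolynomial σ R} (h : ∀ i, pderiv i P = 0) : P = C (constantCoeff P) := by
  classical
  ext s
  rw [coeff_C]
  split_ifs with hs
  · subst hs; rfl
  · obtain ⟨i, hi⟩ : ∃ i, s i ≠ 0 := by
      by_contra! H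
      exact hs (Finsupp.ext fun i => (H i).symm)
    have hle : Finsupp.single i 1 ≤ s := by
      simpa [Finsupp.single_le_iff] using Nat.one_le_iff_ne_zero.2 hi
    have := congrArg (coeff (s - Finsupp.single i 1)) (h i)
    rw [coeff_pderiv, tsub_add_cancel_of_le hle, coeff_zero] at this
    refine (mul_eq_zero.1 this).resolve_right ?_
    exact Nat.cast_add_one_ne_zero _

theorem hasFiniteSupport_normalOrderedTerm (m : ℤ) (P : Px n) :
    (fun q => normalOrderedTerm n r k l m q P).HasFiniteSupport := by
  have h0 := finite_pderiv_ne_zero (injective_mk_sub k l 0) P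
  have hm := finite_pderiv_ne_zero (injective_mk_sub k l m) P
  refine ((h0.union hm).union (Set.finite_Ico m 0)).subset fun q hq => ?_
  by_contra h
  simp only [Set.mem_union, Set.mem_ofPred_eq, Set.mem_Ico, not_or, not_not, sub_zero] at h
  obtain ⟨⟨h1, h2⟩, h3⟩ := h
  apply hq
  have h4 : ((k, l, -(m - q)) : XIdx n) = (k, l, q - m) := by rw [neg_sub]
  by_cases hl : (l : ℕ) + 1 ≤ r <;> by_cases hq : 0 ≤ q
  · simp [normalOrderedTerm, aOp, hl, hq, h1]
  · have : ¬ m ≤ q := fun h => h3 ⟨h, by omega⟩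
    simp [normalOrderedTerm, aOp, aStar, hl, hq, h2, this]
  all_goals simp [normalOrderedTerm, aOp, aStar, hl, h2]

/-- `N_{kl,m}` as a linear map. -/
noncomputable def normalOrderedQuadratic (n r : ℕ) (k l : Fin n) (m : ℤ) :
    Module.End ℂ (Px n) where
  toFun P := ∑ᶠ q, normalOrderedTerm n r k l m q P
  map_add' P Q := by
    simp only [map_add]
    exact finsum_add_distrib (hasFiniteSupport_normalOrderedTerm m P)
      (hasFiniteSupport_normalOrderedTerm m Q)
  map_smul' c P := by
    simp only [map_smul, RingHom.id_apply]
    exact (smul_finsum' c (hasFiniteSupport_normalOrderedTerm m P)).symm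

theorem normalOrderedQuadratic_apply (m : ℤ) (P : Px n) :
    normalOrderedQuadratic n r k l m P = ∑ᶠ q, normalOrderedTerm n r k l m q P := rfl

theorem Nop_eq_normalOrderedQuadratic (m : ℤ) (P : Px n) :
    Nop n r k l m P = normalOrderedQuadratic n r k l m P :=
  finsum_congr fun q => by
    unfold normalOrderedTerm
    split_ifs <;> rfl

theorem map_normalOrderedQuadratic {M : Type*} [AddCommMonoid M] (f : Px n →+ M) (m : ℤ)
    (P : Px n) :
    f (normalOrderedQuadratic n r k l m P) = ∑ᶠ q, f (normalOrderedTerm n r k l m q P) :=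
  f.map_finsum (hasFiniteSupport_normalOrderedTerm m P)

theorem normalOrderedQuadratic_lie_eq {m : ℤ} {A B : Module.End ℂ (Px n)} (q₀ : ℤ)
    (h : ∀ q, ⁅normalOrderedTerm n r k l m q, A⁆ = if q = q₀ then B else 0) :
    ⁅normalOrderedQuadratic n r k l m, A⁆ = B := by
  refine LinearMap.ext fun P => ?_
  have hA : A (normalOrderedQuadratic n r k l m P) = _ :=
    map_normalOrderedQuadratic A.toAddMonoidHom m P
  have hfin : (fun q => A (normalOrderedTerm n r k l m q P)).HasFiniteSupport :=
    (hasFiniteSupport_normalOrderedTerm m P).subset fun q hq h0 =>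
      hq ((congrArg A h0).trans (map_zero A))
  have hq (q : ℤ) : normalOrderedTerm n r k l m q (A P) - A (normalOrderedTerm n r k l m q P) =
      if q = q₀ then B P else 0 := by
    have := LinearMap.congr_fun (h q) P
    split_ifs at this ⊢ <;> simpa [Ring.lie_def] using this
  rw [Ring.lie_def, LinearMap.sub_apply, Module.End.mul_apply, Module.End.mul_apply, hA,
    normalOrderedQuadratic_apply]
  refine (finsum_sub_distrib (hasFiniteSupport_normalOrderedTerm m (A P)) hfin).symm.trans ?_
  simp only [hq]
  rw [finsum_eq_single _ q₀ fun q hq => if_neg hq, if_pos rfl]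

theorem lie_neg_eq_lie {A : Type*} [Ring A] (x y : A) : ⁅x, -y⁆ = ⁅y, x⁆ := by
  simp [Ring.lie_def]; abel

theorem mul_lie_of_lie_eq_ite {A : Type*} [Ring A] {x y z : A} {p : Prop} [Decidable p]
    (hxz : ⁅x, z⁆ = if p then 1 else 0) (hyz : Commute y z) :
    ⁅x * y, z⁆ = (if p then y else 0) ∧ ⁅y * x, z⁆ = if p then y else 0 := by
  rw [Ring.lie_def, sub_eq_iff_eq_add] at hxz
  simp only [Ring.lie_def]
  constructor
  · rw [mul_assoc, hyz.eq, ← mul_assoc, hxz]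
    split_ifs <;> simp [add_mul, mul_assoc]
  · rw [mul_assoc, hxz, ← mul_assoc z, ← hyz.eq]
    split_ifs <;> simp [mul_add, mul_assoc]

theorem mul_lie_of_lie_eq_ite' {A : Type*} [Ring A] {x y z : A} {p : Prop} [Decidable p]
    (hxz : Commute x z) (hzy : ⁅z, y⁆ = if p then 1 else 0) :
    ⁅x * y, z⁆ = (if p then -x else 0) ∧ ⁅y * x, z⁆ = if p then -x else 0 := by
  rw [Ring.lie_def, sub_eq_iff_eq_add] at hzy
  simp only [Ring.lie_def]
  constructor
  · rw [← mul_assoc, ← hxz.eq, mul_assoc, mul_assoc, hzy]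
    split_ifs <;> simp [mul_add]
  · rw [← mul_assoc, hzy, mul_assoc, hxz.eq]
    split_ifs <;> simp [add_mul, mul_assoc]

theorem commute_lie_iff {A : Type*} [Ring A] {x y z : A} :
    Commute ⁅x, y⁆ z ↔ ⁅x, ⁅y, z⁆⁆ = ⁅y, ⁅x, z⁆⁆ := by
  rw [commute_iff_lie_eq, ← sub_eq_zero (a := ⁅x, ⁅y, z⁆⁆)]
  simp only [Ring.lie_def]
  noncomm_ring

theorem commute_lie_of_lie {ι A : Type*} [AddCommGroup ι] [Ring A] {x y : A} {m p : ι}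
    {f : ι → A} (hx : ∀ s, ⁅x, f s⁆ = f (m + s)) (hy : ∀ s, ⁅y, f s⁆ = f (p + s)) (s : ι) :
    Commute ⁅x, y⁆ (f s) := by
  rw [commute_lie_iff, hx, hy, hx, hy, add_left_comm]

theorem commute_lie_of_lie_neg {ι A : Type*} [AddCommGroup ι] [Ring A] {x y : A} {m p : ι}
    {f : ι → A} (hx : ∀ s, ⁅x, f s⁆ = -f (m + s)) (hy : ∀ s, ⁅y, f s⁆ = -f (p + s)) (s : ι) :
    Commute ⁅x, y⁆ (f s) := by
  have hneg (z w : A) : ⁅z, -w⁆ = -⁅z, w⁆ := by simp only [Ring.lie_def]; noncomm_ring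
  rw [commute_lie_iff, hx, hy, hneg, hneg, hx, hy, add_left_comm]

theorem mulLeft_commute {σ : Type*} (P Q : MvPolynomial σ ℂ) :
    Commute (LinearMap.mulLeft ℂ P) (LinearMap.mulLeft ℂ Q) :=
  LinearMap.ext fun S => mul_left_comm P Q S

theorem pderiv_commute {σ : Type*} (i j : σ) :
    Commute ((pderiv i).toLinearMap : Module.End ℂ (MvPolynomial σ ℂ)) (pderiv j).toLinearMap :=
  LinearMap.ext fun S => pderiv_comm_apply i j S

theorem pderiv_lie_mulLeft_X {σ : Type*} [DecidableEq σ] (i j : σ) :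
    ⁅((pderiv i).toLinearMap : Module.End ℂ (MvPolynomial σ ℂ)),
      (LinearMap.mulLeft ℂ (X j) : Module.End ℂ (MvPolynomial σ ℂ))⁆ =
      if i = j then 1 else 0 := by
  refine LinearMap.ext fun S => ?_
  by_cases h : i = j
  · subst h; simp [Ring.lie_def, Derivation.leibniz]
  · simp [Ring.lie_def, Derivation.leibniz, pderiv_X_of_ne (Ne.symm h), h]

theorem pderiv_commute_mulLeft_X {σ : Type*} {i j : σ} (h : i ≠ j) :
    Commute ((pderiv i).toLinearMap : Module.End ℂ (MvPolynomial σ ℂ))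
      (LinearMap.mulLeft ℂ (X j)) := by
  classical
  rw [commute_iff_lie_eq, pderiv_lie_mulLeft_X, if_neg h]

theorem commute_neg_pderiv {σ : Type*} {A : Module.End ℂ (MvPolynomial σ ℂ)} {i : σ}
    (h : Commute A (pderiv i).toLinearMap) : Commute A (-(pderiv i).toLinearMap) :=
  Commute.neg_right (R := Module.End ℂ (MvPolynomial σ ℂ)) h

theorem aOp_commute_aOp (q s : ℤ) : Commute (aOp n r k l q) (aOp n r k l s) := by
  have hne {q s : ℤ} (h : q ≠ s) : ((k, l, q) : XIdx n) ≠ (k, l, s) := by simpa using h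
  unfold aOp
  split_ifs with h1 h2 h2
  · exact pderiv_commute _ _
  · exact pderiv_commute_mulLeft_X (hne (by omega))
  · exact (pderiv_commute_mulLeft_X (hne (by omega))).symm
  · exact mulLeft_commute _ _

theorem aStar_commute_aStar (q s : ℤ) : Commute (aStar n r k l q) (aStar n r k l s) := by
  have hne {q s : ℤ} (h : q ≠ s) : ((k, l, q) : XIdx n) ≠ (k, l, s) := by simpa using h
  unfold aStar
  split_ifs with h1 h2 h2
  · exact mulLeft_commute _ _
  · exact (commute_neg_pderiv (pderiv_commute_mulLeft_X (hne (by omega))).symm)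
  · exact (commute_neg_pderiv (pderiv_commute_mulLeft_X (hne (by omega))).symm).symm
  · exact (commute_neg_pderiv (commute_neg_pderiv (pderiv_commute _ _)).symm)

theorem aOp_lie_aStar (q s : ℤ) :
    ⁅aOp n r k l q, aStar n r k l s⁆ = if q + s = 0 then 1 else 0 := by
  unfold aOp aStar
  by_cases h1 : 0 ≤ q ∧ (l : ℕ) + 1 ≤ r <;> by_cases h2 : s ≤ 0 ∧ (l : ℕ) + 1 ≤ r
  · have h : (k, l, q) = (k, l, -s) ↔ q + s = 0 := by simp [eq_neg_iff_add_eq_zero]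
    rw [if_pos h1, if_pos h2, pderiv_lie_mulLeft_X]
    simp only [h]
  · rw [if_pos h1, if_neg h2, if_neg (by omega)]
    exact (commute_neg_pderiv (pderiv_commute _ _)).lie_eq
  · rw [if_neg h1, if_pos h2, if_neg (by omega)]
    exact (mulLeft_commute _ _).lie_eq
  · have h : (k, l, -s) = (k, l, q) ↔ q + s = 0 := by
      simp [neg_eq_iff_add_eq_zero, add_comm]
    rw [if_neg h1, if_neg h2]
    refine (lie_neg_eq_lie _ _).trans ?_
    rw [pderiv_lie_mulLeft_X]
    simp only [h]

theorem normalOrderedTerm_lie_aOp (m q s : ℤ) :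
    ⁅normalOrderedTerm n r k l m q, aOp n r k l s⁆ =
      if q = m + s then -aOp n r k l (m + s) else 0 := by
  have key := mul_lie_of_lie_eq_ite' (aOp_commute_aOp (r := r) (k := k) (l := l) q s)
    (aOp_lie_aStar s (m - q))
  have h : (if s + (m - q) = 0 then -aOp n r k l q else 0) =
      if q = m + s then -aOp n r k l (m + s) else 0 := by
    grind
  rw [normalOrderedTerm, apply_ite (⁅·, _⁆), key.1, key.2, ite_self, h]

theorem normalOrderedTerm_lie_aStar (m q s : ℤ) :
    ⁅normalOrderedTerm n r k l m q, aStar n r k l s⁆ =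
      if q = -s then aStar n r k l (m + s) else 0 := by
  have key := mul_lie_of_lie_eq_ite (aOp_lie_aStar (r := r) (k := k) (l := l) q s)
    (aStar_commute_aStar (m - q) s)
  have h : (if q + s = 0 then aStar n r k l (m - q) else 0) =
      if q = -s then aStar n r k l (m + s) else 0 := by
    grind
  rw [normalOrderedTerm, apply_ite (⁅·, _⁆), key.1, key.2, ite_self, h]

theorem normalOrderedQuadratic_lie_aOp (m s : ℤ) :
    ⁅normalOrderedQuadratic n r k l m, aOp n r k l s⁆ = -aOp n r k l (m + s) :=
  normalOrderedQuadratic_lie_eq (m + s) fun q => normalOrderedTerm_lie_aOp m q s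

theorem normalOrderedQuadratic_lie_aStar (m s : ℤ) :
    ⁅normalOrderedQuadratic n r k l m, aStar n r k l s⁆ = aStar n r k l (m + s) :=
  normalOrderedQuadratic_lie_eq (-s) fun q => normalOrderedTerm_lie_aStar m q s

theorem normalOrderedQuadratic_commute_of_commute {A : Module.End ℂ (Px n)} (m : ℤ)
    (ha : ∀ q, Commute (aOp n r k l q) A) (hs : ∀ q, Commute (aStar n r k l q) A) :
    Commute (normalOrderedQuadratic n r k l m) A := by
  rw [commute_iff_lie_eq]
  refine normalOrderedQuadratic_lie_eq 0 fun q => ?_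
  rw [ite_self, ← commute_iff_lie_eq]
  unfold normalOrderedTerm
  split_ifs
  · exact (hs _).mul_left (ha _)
  · exact (ha _).mul_left (hs _)

theorem commute_lie_normalOrderedQuadratic_aOp (m p s : ℤ) :
    Commute ⁅normalOrderedQuadratic n r k l m, normalOrderedQuadratic n r k l p⁆
      (aOp n r k l s) :=
  commute_lie_of_lie_neg (normalOrderedQuadratic_lie_aOp m) (normalOrderedQuadratic_lie_aOp p) s

theorem commute_lie_normalOrderedQuadratic_aStar (m p s : ℤ) :
    Commute ⁅normalOrderedQuadratic n r k l m, normalOrderedQuadratic n r k l p⁆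
      (aStar n r k l s) :=
  commute_lie_of_lie (normalOrderedQuadratic_lie_aStar m) (normalOrderedQuadratic_lie_aStar p) s

theorem Commute.lie_left_of_commute {A : Type*} [Ring A] {x y z : A} (hx : Commute x z)
    (hy : Commute y z) : Commute ⁅x, y⁆ z :=
  (hx.mul_left hy).sub_left (hy.mul_left hx)

theorem commute_lie_normalOrderedQuadratic_mulLeft_X (m p : ℤ) (v : XIdx n) :
    Commute ⁅normalOrderedQuadratic n r k l m, normalOrderedQuadratic n r k l p⁆
      (LinearMap.mulLeft ℂ (X v)) := by
  by_cases hv : v = (k, l, v.2.2)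
  · rw [hv]
    generalize v.2.2 = s
    by_cases h : 0 ≤ s ∧ (l : ℕ) + 1 ≤ r
    · simpa [aStar, h] using
        commute_lie_normalOrderedQuadratic_aStar (r := r) (k := k) (l := l) m p (-s)
    · simpa only [aOp, if_neg h] using
        commute_lie_normalOrderedQuadratic_aOp (r := r) (k := k) (l := l) m p s
  · have hd (q : ℤ) : Commute ((pderiv (k, l, q)).toLinearMap : Module.End ℂ (Px n))
        (LinearMap.mulLeft ℂ (X v)) :=
      pderiv_commute_mulLeft_X (by rintro rfl; exact hv rfl)
    have ha (q : ℤ) : Commute (aOp n r k l q) (LinearMap.mulLeft ℂ (X v)) := by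
      unfold aOp; split_ifs
      exacts [hd q, mulLeft_commute _ _]
    have hs (q : ℤ) : Commute (aStar n r k l q) (LinearMap.mulLeft ℂ (X v)) := by
      unfold aStar; split_ifs
      exacts [mulLeft_commute _ _, (commute_neg_pderiv (hd (-q)).symm).symm]
    exact (normalOrderedQuadratic_commute_of_commute m ha hs).lie_left_of_commute
      (normalOrderedQuadratic_commute_of_commute p ha hs)

theorem commute_lie_normalOrderedQuadratic_pderiv (m p : ℤ) (v : XIdx n) :
    Commute ⁅normalOrderedQuadratic n r k l m, normalOrderedQuadratic n r k l p⁆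
      (pderiv v).toLinearMap := by
  by_cases hv : v = (k, l, v.2.2)
  · rw [hv]
    generalize v.2.2 = s
    by_cases h : 0 ≤ s ∧ (l : ℕ) + 1 ≤ r
    · simpa [aOp, h] using
        commute_lie_normalOrderedQuadratic_aOp (r := r) (k := k) (l := l) m p s
    · have hs : ¬(-s ≤ 0 ∧ (l : ℕ) + 1 ≤ r) := by rwa [neg_nonpos]
      have := commute_lie_normalOrderedQuadratic_aStar (r := r) (k := k) (l := l) m p (-s)
      rw [aStar, if_neg hs, neg_neg] at this
      simpa only [neg_neg] using Commute.neg_right (R := Module.End ℂ (Px n)) this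
  · have hX (q : ℤ) : Commute (LinearMap.mulLeft ℂ (X (k, l, q)) : Module.End ℂ (Px n))
        (pderiv v).toLinearMap :=
      (pderiv_commute_mulLeft_X (by rintro rfl; exact hv rfl)).symm
    have ha (q : ℤ) : Commute (aOp n r k l q) (pderiv v).toLinearMap := by
      unfold aOp; split_ifs
      exacts [pderiv_commute _ _, hX q]
    have hs (q : ℤ) : Commute (aStar n r k l q) (pderiv v).toLinearMap := by
      unfold aStar; split_ifs
      exacts [hX _, (commute_neg_pderiv (pderiv_commute _ _)).symm]
    exact (normalOrderedQuadratic_commute_of_commute m ha hs).lie_left_of_commute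
      (normalOrderedQuadratic_commute_of_commute p ha hs)

theorem apply_eq_mul_of_commute_mulLeft_X {σ R : Type*} [CommRing R]
    {A : Module.End R (MvPolynomial σ R)} (h : ∀ v, Commute A (LinearMap.mulLeft R (X v)))
    (P : MvPolynomial σ R) : A P = P * A 1 := by
  induction P using MvPolynomial.induction_on with
  | C a => rw [← mul_one (C a), ← smul_eq_C_mul, map_smul, smul_mul_assoc, one_mul]
  | add P Q hP hQ => rw [map_add, hP, hQ, add_mul]
  | mul_X P v hP =>
    have := LinearMap.congr_fun (h v) P
    simp only [Module.End.mul_apply, LinearMap.mulLeft_apply] at this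
    rw [mul_comm P, this, hP, mul_assoc]

theorem lie_normalOrderedQuadratic_apply (m p : ℤ) (P : Px n) :
    ⁅normalOrderedQuadratic n r k l m, normalOrderedQuadratic n r k l p⁆ P =
      constantCoeff (⁅normalOrderedQuadratic n r k l m, normalOrderedQuadratic n r k l p⁆ 1) •
        P := by
  rw [apply_eq_mul_of_commute_mulLeft_X (commute_lie_normalOrderedQuadratic_mulLeft_X m p),
    smul_eq_C_mul, mul_comm P, ← eq_C_of_pderiv_eq_zero]
  intro v
  have := LinearMap.congr_fun
    (commute_lie_normalOrderedQuadratic_pderiv (r := r) (k := k) (l := l) m p v) 1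
  simpa using this.symm

theorem normalOrderedTerm_one_eq_zero {m q : ℤ} (h : (l : ℕ) + 1 ≤ r → 0 ≤ m ∨ 0 ≤ q) :
    normalOrderedTerm n r k l m q 1 = 0 := by
  by_cases hl : (l : ℕ) + 1 ≤ r <;> by_cases hq : 0 ≤ q
  · simp [normalOrderedTerm, aOp, hl, hq]
  · have : ¬ m ≤ q := by have := h hl; omega
    simp [normalOrderedTerm, aStar, hl, hq, this]
  all_goals simp [normalOrderedTerm, aStar, hl]

theorem normalOrderedQuadratic_one_eq_zero {m : ℤ} (h : (l : ℕ) + 1 ≤ r → 0 ≤ m) :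
    normalOrderedQuadratic n r k l m 1 = 0 :=
  finsum_eq_zero_of_forall_eq_zero fun _ => normalOrderedTerm_one_eq_zero fun hl => .inl (h hl)

theorem constantCoeff_normalOrderedQuadratic_of_nonpos {m : ℤ} (hm : m ≤ 0) (P : Px n) :
    constantCoeff (normalOrderedQuadratic n r k l m P) = 0 := by
  refine (map_normalOrderedQuadratic (constantCoeff : Px n →+* ℂ).toAddMonoidHom m P).trans
    (finsum_eq_zero_of_forall_eq_zero fun q => ?_)
  by_cases hl : (l : ℕ) + 1 ≤ r <;> by_cases hq : 0 ≤ q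
  · simp [normalOrderedTerm, aStar, hl, hq, hm.trans hq]
  all_goals simp [normalOrderedTerm, aOp, hl, hq]

theorem constantCoeff_normalOrderedQuadratic_normalOrderedTerm_one (hl : (l : ℕ) + 1 ≤ r)
    (m p s : ℤ) :
    constantCoeff (normalOrderedQuadratic n r k l m (normalOrderedTerm n r k l p s 1)) =
      if m + p = 0 ∧ s ∈ Finset.Ico (-m) 0 then -1 else 0 := by
  simp only [Finset.mem_Ico]
  by_cases hs : 0 ≤ s
  · rw [normalOrderedTerm_one_eq_zero fun _ => .inr hs, map_zero, map_zero, if_neg (by omega)]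
  have hT : normalOrderedTerm n r k l p s = aOp n r k l s * aStar n r k l (p - s) := by
    simp [normalOrderedTerm, hs]
  have h1 := LinearMap.congr_fun (normalOrderedQuadratic_lie_aOp (r := r) (k := k) (l := l) m s)
    (aStar n r k l (p - s) 1)
  have ha (P : Px n) : constantCoeff (aOp n r k l s P) = 0 := by simp [aOp, hs]
  simp only [Ring.lie_def, LinearMap.sub_apply, Module.End.mul_apply, LinearMap.neg_apply,
    sub_eq_iff_eq_add] at h1
  rw [hT, Module.End.mul_apply, h1, map_add, ha, add_zero, map_neg]
  by_cases hms : 0 ≤ m + s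
  · by_cases hps : p ≤ s
    · by_cases hmp : m + p = 0
      · have : s - p = m + s := by omega
        simp [aOp, aStar, hl, hms, hps, hmp, this]
        omega
      · have : ((k, l, s - p) : XIdx n) ≠ (k, l, m + s) := by
          simp only [ne_eq, Prod.mk.injEq, true_and]; omega
        simp [aOp, aStar, hl, hms, hps, hmp, pderiv_X_of_ne this]
    · rw [if_neg (by omega)]
      simp [aStar, hps]
  · rw [if_neg (by omega)]
    simp [aOp, hms]

theorem constantCoeff_normalOrderedQuadratic_normalOrderedQuadratic_one
    (hl : (l : ℕ) + 1 ≤ r) {m : ℤ} (hm : 0 ≤ m) (p : ℤ) :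
    constantCoeff (normalOrderedQuadratic n r k l m (normalOrderedQuadratic n r k l p 1)) =
      if m + p = 0 then -(m : ℂ) else 0 := by
  refine (map_normalOrderedQuadratic ((constantCoeff : Px n →+* ℂ).toAddMonoidHom.comp
    (normalOrderedQuadratic n r k l m).toAddMonoidHom) p 1).trans ?_
  refine (finsum_congr fun s =>
    constantCoeff_normalOrderedQuadratic_normalOrderedTerm_one hl m p s).trans ?_
  split_ifs with h
  · simp only [h, true_and]
    rw [finsum_eq_sum_of_support_subset (s := Finset.Ico (-m) 0) _ (by
      intro s hs
      by_contra h'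
      exact hs (if_neg h')), Finset.sum_ite_mem, Finset.inter_self]
    have : ((m.toNat : ℤ) : ℂ) = m := congrArg _ (Int.toNat_of_nonneg hm)
    rw [Int.cast_natCast] at this
    simp [this]
  · simp [h]

theorem constantCoeff_lie_normalOrderedQuadratic_one (m p : ℤ) :
    constantCoeff (⁅normalOrderedQuadratic n r k l m, normalOrderedQuadratic n r k l p⁆ 1) =
      -(if (l : ℕ) + 1 ≤ r then (1 : ℂ) else 0) * (m : ℂ) * (if m + p = 0 then 1 else 0) := by
  rw [Ring.lie_def, LinearMap.sub_apply, Module.End.mul_apply, Module.End.mul_apply, map_sub]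
  by_cases hl : (l : ℕ) + 1 ≤ r
  · rcases le_total 0 m with hm | hm
    · rw [normalOrderedQuadratic_one_eq_zero (m := m) fun _ => hm,
        constantCoeff_normalOrderedQuadratic_normalOrderedQuadratic_one hl hm]
      simp [hl]
    rcases le_total 0 p with hp | hp
    · rw [normalOrderedQuadratic_one_eq_zero (m := p) fun _ => hp,
        constantCoeff_normalOrderedQuadratic_normalOrderedQuadratic_one hl hp]
      by_cases h : m + p = 0
      · obtain rfl : p = -m := by omega
        simp [hl]
      · simp [h, add_comm p m]
    · rw [constantCoeff_normalOrderedQuadratic_of_nonpos hm,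
        constantCoeff_normalOrderedQuadratic_of_nonpos hp]
      by_cases h : m + p = 0
      · obtain rfl : m = 0 := by omega
        simp
      · simp [h]
  · rw [normalOrderedQuadratic_one_eq_zero fun h => absurd h hl,
      normalOrderedQuadratic_one_eq_zero fun h => absurd h hl]
    simp [hl]

end Oscillators

/-- `[N_{kl,m}, N_{kl,p}] = −δ_{l≤r} m δ_{m+p,0} id`. -/
theorem normal_ordered_quadratic_commutator (n r : ℕ) (hn : 1 ≤ n) (hr : r ≤ n)
    (k l : Fin n) (hkl : k ≤ l) (m p : ℤ) (P : Px n) :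
    Nop n r k l m (Nop n r k l p P) - Nop n r k l p (Nop n r k l m P) =
      (-(if (l : ℕ) + 1 ≤ r then (1 : ℂ) else 0) * (m : ℂ) *
        (if m + p = 0 then 1 else 0)) • P := by
  simp only [Nop_eq_normalOrderedQuadratic]
  rw [← constantCoeff_lie_normalOrderedQuadratic_one (k := k), ← lie_normalOrderedQuadratic_apply]
  rfl
end

section
/- For all 1 ≤ i ≤ n, all 1 ≤ k ≤ l ≤ n and all m, p ∈ ℤ, [ℋ_{i,m}, a_{kl,p}] = −(α_i|α_{kl}) · a_{kl,m+p} as linear operators on ℂ[x]. -/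
open MvPolynomial

/-- The Cartan matrix of `sl(n+1, ℂ)` (indices `0, …, n-1` represent `1, …, n`). -/
def cartan (n : ℕ) (i j : Fin n) : ℤ :=
  if i = j then 2 else if (i : ℕ) + 1 = (j : ℕ) ∨ (j : ℕ) + 1 = (i : ℕ) then -1 else 0

/-- The pairing `(α_i | α_{kl}) = Σ_{s=k}^{l} A_{is}` of a simple root with the positive
root `α_k + ⋯ + α_l`. -/
def pairRoot (n : ℕ) (i k l : Fin n) : ℤ :=
  ∑ s ∈ Finset.Icc k l, cartan n i s

/-- The operator `ℋ_{i,m} = Σ_{1 ≤ k ≤ l ≤ n} (α_i|α_{kl}) N_{kl,m}`. -/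
noncomputable def Hcal (n r : ℕ) (i : Fin n) (m : ℤ) (P : Px n) : Px n :=
  ∑ k : Fin n, ∑ l : Fin n,
    if k ≤ l then (pairRoot n i k l : ℂ) • Nop n r k l m P else 0

/-- Partial derivatives of multivariate polynomials commute. -/
theorem pderiv_pderiv_comm {σ : Type*} (s t : σ) (P : MvPolynomial σ ℂ) :
    pderiv s (pderiv t P) = pderiv t (pderiv s P) := by
  classical
  have h : ⁅(pderiv s : Derivation ℂ (MvPolynomial σ ℂ) (MvPolynomial σ ℂ)),
      (pderiv t : Derivation ℂ (MvPolynomial σ ℂ) (MvPolynomial σ ℂ))⁆ = 0 := by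
    refine MvPolynomial.derivation_ext fun u => ?_
    simp only [Derivation.commutator_apply, pderiv_X, Pi.single_apply]
    split_ifs <;> simp
  have h' := DFunLike.congr_fun h P
  rwa [Derivation.commutator_apply, Derivation.zero_apply, sub_eq_zero] at h'

theorem aOp_aOp_comm (n r : ℕ) (i j k l : Fin n) (p q : ℤ) (P : Px n) :
    aOp n r i j p (aOp n r k l q P) = aOp n r k l q (aOp n r i j p P) := by
  classical
  unfold aOp
  split_ifs with h₁ h₂ h₂
  · exact pderiv_pderiv_comm _ _ P
  · have hne : (k, l, q) ≠ (i, j, p) := by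
      rintro ⟨⟩
      exact h₂ h₁
    simp [pderiv_X_of_ne hne]
  · have hne : (i, j, p) ≠ (k, l, q) := by
      rintro ⟨⟩
      exact h₁ h₂
    simp [pderiv_X_of_ne hne]
  · simp [mul_left_comm]

/-- The canonical commutation relation `[a_{ij,p}, a*_{kl,s}] = δ_{ik} δ_{jl} δ_{p+s,0}`. -/
theorem aOp_aStar_commutator (n r : ℕ) (i j k l : Fin n) (p s : ℤ) (P : Px n) :
    aOp n r i j p (aStar n r k l s P) - aStar n r k l s (aOp n r i j p P) =
      if (k, l, -s) = (i, j, p) then P else 0 := by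
  classical
  unfold aOp aStar
  split_ifs with h₁ h₂ h h h₂ h h
  · simp [h, mul_comm]
  · simp [pderiv_X_of_ne h]
  · obtain ⟨rfl, rfl, rfl⟩ : k = i ∧ l = j ∧ -s = p := by simpa using h
    exact absurd ⟨by omega, h₁.2⟩ h₂
  · simp [pderiv_pderiv_comm (i, j, p)]
  · obtain ⟨rfl, rfl, rfl⟩ : k = i ∧ l = j ∧ -s = p := by simpa using h
    exact absurd ⟨by omega, h₂.2⟩ h₁
  · simp [mul_left_comm]
  · simp [h, mul_comm]
  · simp [pderiv_X_of_ne (Ne.symm h)]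

/-- The normally ordered product `:a_{kl,q} a*_{kl,m-q}:`. -/
noncomputable def normalProd (n r : ℕ) (k l : Fin n) (m q : ℤ) (P : Px n) : Px n :=
  if 0 ≤ q ∧ (l : ℕ) + 1 ≤ r then aStar n r k l (m - q) (aOp n r k l q P)
  else aOp n r k l q (aStar n r k l (m - q) P)

theorem normalProd_support_finite (n r : ℕ) (k l : Fin n) (m : ℤ) (P : Px n) :
    (Function.support fun q => normalProd n r k l m q P).Finite := by
  have hfin (c : ℤ) : {q : ℤ | (k, l, q - c) ∈ P.vars}.Finite :=
    P.vars.finite_toSet.preimage (f := fun q : ℤ => (k, l, q - c)) fun a _ b _ hab => by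
      simpa using hab
  refine (((hfin 0).union (hfin m)).union (Set.finite_Icc m 0)).subset fun q hq => ?_
  by_contra hn
  simp only [Set.mem_union, Set.mem_ofPred_eq, sub_zero, Set.mem_Icc, not_or] at hn
  obtain ⟨⟨h₀, hm⟩, hI⟩ := hn
  apply hq
  simp only [normalProd]
  split_ifs with h
  · simp [aOp, h, pderiv_eq_zero_of_notMem_vars h₀]
  · rw [aStar, if_neg fun hs => by omega]
    simp [pderiv_eq_zero_of_notMem_vars hm]

theorem normalProd_aOp_commutator (n r : ℕ) (i j k l : Fin n) (m p q : ℤ) (P : Px n) :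
    normalProd n r k l m q (aOp n r i j p P) - aOp n r i j p (normalProd n r k l m q P) =
      if (k, l, q) = (i, j, m + p) then -aOp n r k l q P else 0 := by
  have hiff : (k, l, -(m - q)) = (i, j, p) ↔ (k, l, q) = (i, j, m + p) := by
    simp only [Prod.mk.injEq]
    omega
  unfold normalProd
  split_ifs with h₁ h₂ h₂
  all_goals
    have hc (Q : Px n) := aOp_aStar_commutator n r i j k l p (m - q) Q
    simp only [hiff, h₂, if_true, if_false] at hc
  · rw [aOp_aOp_comm n r k l i j, ← neg_sub, hc]
  · rw [aOp_aOp_comm n r k l i j, ← neg_sub, hc, neg_zero]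
  · rw [aOp_aOp_comm n r i j k l, ← map_sub, ← neg_sub, hc, map_neg]
  · rw [aOp_aOp_comm n r i j k l, ← map_sub, ← neg_sub, hc, neg_zero, map_zero]

/-- `[N_{kl,m}, a_{ij,p}] = −δ_{ik} δ_{jl} a_{ij,m+p}`. -/
theorem Nop_aOp_commutator (n r : ℕ) (i j k l : Fin n) (m p : ℤ) (P : Px n) :
    Nop n r k l m (aOp n r i j p P) - aOp n r i j p (Nop n r k l m P) =
      if k = i ∧ l = j then -aOp n r i j (m + p) P else 0 := by
  have hN (Q : Px n) : Nop n r k l m Q = ∑ᶠ q : ℤ, normalProd n r k l m q Q := rfl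
  have hfin := normalProd_support_finite n r k l m P
  have hmap : aOp n r i j p (∑ᶠ q : ℤ, normalProd n r k l m q P) =
      ∑ᶠ q : ℤ, aOp n r i j p (normalProd n r k l m q P) :=
    (aOp n r i j p).toAddMonoidHom.map_finsum hfin
  have hfin' : (Function.support fun q => aOp n r i j p (normalProd n r k l m q P)).Finite :=
    hfin.subset fun q hq h => hq (by simp only at h ⊢; rw [h, map_zero])
  rw [hN, hN, hmap, ← finsum_sub_distrib (normalProd_support_finite n r k l m _) hfin']
  simp only [normalProd_aOp_commutator, Prod.mk.injEq]
  rw [finsum_eq_single _ (m + p) fun q hq => if_neg fun h => hq h.2.2]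
  by_cases h : k = i ∧ l = j
  · obtain ⟨rfl, rfl⟩ := h
    simp
  · rw [if_neg h, if_neg fun h' => h ⟨h'.1, h'.2.1⟩]

/-- `[ℋ_{i,m}, a_{kl,p}] = −(α_i|α_{kl}) a_{kl,m+p}`. -/
theorem Hcal_a_commutator (n r : ℕ) (hn : 1 ≤ n) (hr : r ≤ n)
    (i k l : Fin n) (hkl : k ≤ l) (m p : ℤ) (P : Px n) :
    Hcal n r i m (aOp n r k l p P) - aOp n r k l p (Hcal n r i m P) =
      (-(pairRoot n i k l : ℂ)) • aOp n r k l (m + p) P := by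
  have hterm (k' l' : Fin n) :
      (if k' ≤ l' then (pairRoot n i k' l' : ℂ) • Nop n r k' l' m (aOp n r k l p P) else 0) -
        aOp n r k l p (if k' ≤ l' then (pairRoot n i k' l' : ℂ) • Nop n r k' l' m P else 0) =
      if k' = k then if l' = l then (-(pairRoot n i k l : ℂ)) • aOp n r k l (m + p) P else 0
        else 0 := by
    by_cases hle : k' ≤ l'
    · simp only [if_pos hle]
      rw [map_smul, ← smul_sub, Nop_aOp_commutator, ← ite_and]
      by_cases h : k' = k ∧ l' = l
      · rw [if_pos h, if_pos h, h.1, h.2, smul_neg, neg_smul]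
      · rw [if_neg h, if_neg h, smul_zero]
    · rw [if_neg hle, if_neg hle, map_zero, sub_zero, ← ite_and, if_neg]
      rintro ⟨rfl, rfl⟩
      exact hle hkl
  simp only [Hcal, map_sum, ← Finset.sum_sub_distrib, hterm]
  simp
end

section
/- For all 1 ≤ i ≤ n, all 1 ≤ k ≤ l ≤ n and all m, p ∈ ℤ, [ℋ_{i,m}, a*_{kl,p}] = (α_i|α_{kl}) · a*_{kl,m+p} as linear operators on ℂ[x]. -/
open MvPolynomial

/-- Partial derivatives of polynomials commute. -/
theorem pderiv_commute_s9 {σ R : Type*} [CommRing R] (s t : σ) (P : MvPolynomial σ R) :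
    pderiv s (pderiv t P) = pderiv t (pderiv s P) := by
  classical
  have h : ⁅pderiv (R := R) s, pderiv (R := R) t⁆ = 0 := by
    refine derivation_ext fun u => ?_
    rw [Derivation.commutator_apply, pderiv_X, pderiv_X, Pi.single_apply, Pi.single_apply]
    split_ifs <;> simp
  rw [← sub_eq_zero, ← Derivation.commutator_apply, h, Derivation.zero_apply]

/-- The operators `a*` commute with each other. -/
theorem aStar_aStar_comm (n r : ℕ) (k l k' l' : Fin n) (p p' : ℤ) (P : Px n) :
    aStar n r k l p (aStar n r k' l' p' P) = aStar n r k' l' p' (aStar n r k l p P) := by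
  classical
  unfold aStar
  split_ifs with h h' h'
  · simp [mul_left_comm]
  · have : (k, l, -p) ≠ (k', l', -p') := by
      simp only [ne_eq, Prod.mk.injEq, not_and]
      rintro rfl rfl
      omega
    simp [pderiv_X_of_ne this]
  · have : (k', l', -p') ≠ (k, l, -p) := by
      simp only [ne_eq, Prod.mk.injEq, not_and]
      rintro rfl rfl
      omega
    simp [pderiv_X_of_ne this]
  · simp [pderiv_commute_s9 (k, l, -p)]

/-- The canonical commutation relation between `a` and `a*`. -/
theorem aOp_aStar (n r : ℕ) (k l k' l' : Fin n) (q p : ℤ) (P : Px n) :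
    aOp n r k l q (aStar n r k' l' p P) =
      aStar n r k' l' p (aOp n r k l q P) +
        if (k, l, q) = (k', l', -p) then P else 0 := by
  classical
  unfold aOp aStar
  by_cases he : (k, l, q) = (k', l', -p)
  · rw [if_pos he]
    obtain ⟨rfl, rfl, rfl⟩ : k = k' ∧ l = l' ∧ q = -p := by simpa using he
    split_ifs with h h' h'
    · simp [add_comm]
    · omega
    · omega
    · simp [add_comm]
  · rw [if_neg he]
    have he' : (k', l', -p) ≠ (k, l, q) := Ne.symm he
    split_ifs with h h' h'
    · simp [pderiv_X_of_ne he']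
    · simp [pderiv_commute_s9 (k, l, q)]
    · simp [mul_left_comm]
    · simp [pderiv_X_of_ne he]

/-- The summand `:a_{kl,q} a*_{kl,m-q}:` of `Nop`. -/
noncomputable def normalTerm (n r : ℕ) (k l : Fin n) (m q : ℤ) : Module.End ℂ (Px n) :=
  if 0 ≤ q ∧ (l : ℕ) + 1 ≤ r then aStar n r k l (m - q) * aOp n r k l q
  else aOp n r k l q * aStar n r k l (m - q)

theorem Nop_eq_finsum_normalTerm (n r : ℕ) (k l : Fin n) (m : ℤ) (P : Px n) :
    Nop n r k l m P = ∑ᶠ q : ℤ, normalTerm n r k l m q P := by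
  unfold Nop normalTerm
  congr! 2 with q
  split_ifs <;> rfl

theorem finite_pderiv_ne_zero_s9 (n : ℕ) (k l : Fin n) (c : ℤ) (P : Px n) :
    {q : ℤ | pderiv (k, l, q - c) P ≠ 0}.Finite := by
  have hinj : Function.Injective fun q : ℤ => ((k, l, q - c) : XIdx n) := fun a b h => by
    simpa using h
  refine (P.vars.finite_toSet.preimage hinj.injOn).subset fun q hq => ?_
  by_contra hv
  exact hq (pderiv_eq_zero_of_notMem_vars hv)

theorem finite_support_normalTerm (n r : ℕ) (k l : Fin n) (m : ℤ) (P : Px n) :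
    (Function.support fun q : ℤ => normalTerm n r k l m q P).Finite := by
  refine (((finite_pderiv_ne_zero_s9 n k l 0 P).union (finite_pderiv_ne_zero_s9 n k l m P)).union
    (Set.finite_Ico m 0)).subset fun q hq => ?_
  by_contra hc
  simp only [Set.mem_union, Set.mem_ofPred_eq, not_or, not_not, sub_zero, Set.mem_Ico] at hc
  obtain ⟨⟨h0, hm⟩, hI⟩ := hc
  refine hq ?_
  change normalTerm n r k l m q P = 0
  unfold normalTerm
  split_ifs with h
  · simp [aOp, h, h0]
  · have h' : ¬ (m - q ≤ 0 ∧ (l : ℕ) + 1 ≤ r) := by omega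
    rw [aStar, if_neg h']
    simp [hm]

theorem normalTerm_aStar (n r : ℕ) (k l k' l' : Fin n) (m q p : ℤ) (P : Px n) :
    normalTerm n r k l m q (aStar n r k' l' p P) =
      aStar n r k' l' p (normalTerm n r k l m q P) +
        if (k, l, q) = (k', l', -p) then aStar n r k l (m - q) P else 0 := by
  unfold normalTerm
  split_ifs with h he he <;>
    simp [aOp_aStar, he, aStar_aStar_comm n r k l k' l' (m - q)]

/-- `[N_{kl,m}, a*_{k'l',p}] = a*_{kl,m+p}` if `(k, l) = (k', l')`, and it vanishes otherwise. -/
theorem Nop_aStar (n r : ℕ) (k l k' l' : Fin n) (m p : ℤ) (P : Px n) :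
    Nop n r k l m (aStar n r k' l' p P) =
      aStar n r k' l' p (Nop n r k l m P) +
        if k = k' ∧ l = l' then aStar n r k l (m + p) P else 0 := by
  have hfin := finite_support_normalTerm n r k l m P
  have hzero : ∀ q : ℤ, q ≠ -p →
      (if (k, l, q) = (k', l', -p) then aStar n r k l (m - q) P else 0) = 0 := fun q hq =>
    if_neg fun h => hq (by simpa using congrArg (fun x => x.2.2) h)
  simp only [Nop_eq_finsum_normalTerm, normalTerm_aStar]
  rw [finsum_add_distrib, finsum_eq_single _ (-p) hzero]
  · congr 1
    · exact ((aStar n r k' l' p).toAddMonoidHom.map_finsum hfin).symm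
    · simp
  · exact hfin.subset fun q hq h => hq (by simp [h])
  · exact (Set.finite_singleton (-p)).subset fun q hq => by
      by_contra h
      exact hq (hzero q h)

/-- `[ℋ_{i,m}, a*_{kl,p}] = (α_i|α_{kl}) a*_{kl,m+p}`. -/
theorem Hcal_aStar_commutator (n r : ℕ) (hn : 1 ≤ n) (hr : r ≤ n)
    (i k l : Fin n) (hkl : k ≤ l) (m p : ℤ) (P : Px n) :
    Hcal n r i m (aStar n r k l p P) - aStar n r k l p (Hcal n r i m P) =
      ((pairRoot n i k l : ℂ)) • aStar n r k l (m + p) P := by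
  have hterm : ∀ k' l' : Fin n,
      ((if k' ≤ l' then (pairRoot n i k' l' : ℂ) • Nop n r k' l' m (aStar n r k l p P) else 0) -
        aStar n r k l p (if k' ≤ l' then (pairRoot n i k' l' : ℂ) • Nop n r k' l' m P else 0)) =
      if k' = k then if l' = l then (pairRoot n i k l : ℂ) • aStar n r k l (m + p) P else 0
        else 0 := by
    intro k' l'
    by_cases hk : k' = k
    · by_cases hl : l' = l
      · subst hk hl
        simp [hkl, Nop_aStar]
      · by_cases h : k' ≤ l' <;> simp [h, hl, Nop_aStar]
    · by_cases h : k' ≤ l' <;> simp [h, hk, Nop_aStar]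
  simp only [Hcal, map_sum, ← Finset.sum_sub_distrib, hterm]
  simp
end

section
/- For all 1 ≤ i, j ≤ n and all m, p ∈ ℤ, [ℋ_{i,m}, ℋ_{j,p}] = −(α_i|α_j) · ((1 − δ_{i>r}δ_{j>r})(r+1) + (r/2)δ_{i,r+1}δ_{j,r+1}) · m · δ_{m+p,0} · id as linear operators on ℂ[x], where δ_{i>r} is 1 if i > r and 0 otherwise. -/
open MvPolynomial

namespace FockSpace

theorem commute_neg_right {V : Type*} [AddCommGroup V] [Module ℂ V] {f g : Module.End ℂ V}
    (h : Commute f g) : Commute f (-g) :=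
  h.neg_right

theorem mul_neg_eq_of_mul_eq_add {V : Type*} [AddCommGroup V] [Module ℂ V]
    {f g c : Module.End ℂ V} (h : g * f = f * g + c) : f * -g = -g * f + c := by
  rw [mul_neg, neg_mul, h]
  abel

variable {n : ℕ}

/-- Multiplication by the variable `X s`. -/
noncomputable def mulX (s : XIdx n) : Module.End ℂ (Px n) := LinearMap.mulLeft ℂ (X s)

/-- Partial differentiation as a linear endomorphism. -/
noncomputable def partialX (s : XIdx n) : Module.End ℂ (Px n) := (pderiv s).toLinearMap

theorem mulX_apply (s : XIdx n) (P : Px n) : mulX s P = X s * P := rfl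

theorem partialX_apply (s : XIdx n) (P : Px n) : partialX s P = pderiv s P := rfl

theorem aOp_eq (r : ℕ) (k l : Fin n) (m : ℤ) :
    aOp n r k l m = if 0 ≤ m ∧ (l : ℕ) + 1 ≤ r then partialX (k, l, m) else mulX (k, l, m) := rfl

theorem aStar_eq (r : ℕ) (k l : Fin n) (m : ℤ) :
    aStar n r k l m =
      if m ≤ 0 ∧ (l : ℕ) + 1 ≤ r then mulX (k, l, -m) else -partialX (k, l, -m) := rfl

theorem mulX_commute (s t : XIdx n) : Commute (mulX s) (mulX t) := by
  refine LinearMap.ext fun P => ?_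
  simp only [Module.End.mul_apply, mulX_apply]
  ring

theorem partialX_commute (s t : XIdx n) : Commute (partialX s) (partialX t) := by
  have h : ⁅(pderiv s : Derivation ℂ (Px n) (Px n)),
      (pderiv t : Derivation ℂ (Px n) (Px n))⁆ = 0 := by
    refine MvPolynomial.derivation_ext fun i => ?_
    simp only [Derivation.commutator_apply, pderiv_X, Derivation.coe_zero, Pi.zero_apply,
      Pi.single_apply]
    split_ifs <;> simp
  refine LinearMap.ext fun P => ?_
  have := congrArg (fun D : Derivation ℂ (Px n) (Px n) => D P) h
  simpa [Derivation.commutator_apply, sub_eq_zero, partialX_apply] using this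

theorem partialX_mul_mulX (s t : XIdx n) :
    partialX s * mulX t = mulX t * partialX s + if s = t then 1 else 0 := by
  refine LinearMap.ext fun P => ?_
  by_cases h : s = t
  · subst h
    simp [mulX_apply, partialX_apply]
  · simp [pderiv_X_of_ne (Ne.symm h), h, mulX_apply, partialX_apply]

theorem partialX_commute_mulX {s t : XIdx n} (h : s ≠ t) : Commute (partialX s) (mulX t) := by
  have := partialX_mul_mulX s t
  rwa [if_neg h, add_zero] at this

theorem aOp_commute (r : ℕ) (k l k' l' : Fin n) (m p : ℤ) :
    Commute (aOp n r k l m) (aOp n r k' l' p) := by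
  rw [aOp_eq, aOp_eq]
  split_ifs with h₁ h₂ h₂
  · exact partialX_commute _ _
  · exact partialX_commute_mulX (by grind)
  · exact (partialX_commute_mulX (by grind)).symm
  · exact mulX_commute _ _

theorem aStar_commute (r : ℕ) (k l k' l' : Fin n) (m p : ℤ) :
    Commute (aStar n r k l m) (aStar n r k' l' p) := by
  rw [aStar_eq, aStar_eq]
  split_ifs with h₁ h₂ h₂
  · exact mulX_commute _ _
  · exact commute_neg_right (partialX_commute_mulX (by grind)).symm
  · exact (commute_neg_right (partialX_commute_mulX (by grind)).symm).symm
  · exact commute_neg_right (commute_neg_right (partialX_commute _ _)).symm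

theorem aOp_mul_aStar (r : ℕ) (k l k' l' : Fin n) (m p : ℤ) :
    aOp n r k l m * aStar n r k' l' p = aStar n r k' l' p * aOp n r k l m +
      if k = k' ∧ l = l' ∧ m + p = 0 then 1 else 0 := by
  have hiff : (k, l, m) = (k', l', -p) ↔ k = k' ∧ l = l' ∧ m + p = 0 := by
    simp only [Prod.mk.injEq, eq_neg_iff_add_eq_zero]
  simp only [← hiff]
  rw [aOp_eq, aStar_eq]
  by_cases h₁ : 0 ≤ m ∧ (l : ℕ) + 1 ≤ r <;> by_cases h₂ : p ≤ 0 ∧ (l' : ℕ) + 1 ≤ r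
  · rw [if_pos h₁, if_pos h₂, partialX_mul_mulX]
  · rw [if_pos h₁, if_neg h₂, if_neg (by grind), add_zero]
    exact commute_neg_right (partialX_commute _ _)
  · rw [if_neg h₁, if_pos h₂, if_neg (by grind), add_zero]
    exact mulX_commute _ _
  · rw [if_neg h₁, if_neg h₂]
    refine mul_neg_eq_of_mul_eq_add ?_
    rw [partialX_mul_mulX]
    simp only [eq_comm (a := (k', l', -p))]

/-- The normally ordered product `:a_{kl,q} a*_{kl,m-q}:`. -/
noncomputable def normalTerm (r : ℕ) (k l : Fin n) (m q : ℤ) : Module.End ℂ (Px n) :=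
  if 0 ≤ q ∧ (l : ℕ) + 1 ≤ r then aStar n r k l (m - q) * aOp n r k l q
  else aOp n r k l q * aStar n r k l (m - q)

theorem normalTerm_eq (r : ℕ) (k l : Fin n) (m q : ℤ) :
    normalTerm r k l m q = aOp n r k l q * aStar n r k l (m - q) -
      algebraMap ℂ _ (if (0 ≤ q ∧ (l : ℕ) + 1 ≤ r) ∧ m = 0 then 1 else 0) := by
  unfold normalTerm
  rw [aOp_mul_aStar]
  split_ifs <;> grind

theorem normalTerm_mul_aOp (r : ℕ) (k l k' l' : Fin n) (m q s : ℤ) :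
    normalTerm r k l m q * aOp n r k' l' s = aOp n r k' l' s * normalTerm r k l m q +
      if q = m + s then (if k = k' ∧ l = l' then -aOp n r k l (m + s) else 0) else 0 := by
  have h₁ := (aOp_commute r k l k' l' q s).eq
  have h₂ := aOp_mul_aStar r k' l' k l s (m - q)
  have h₃ : aStar n r k l (m - q) * aOp n r k' l' s = aOp n r k' l' s * aStar n r k l (m - q) -
      if k' = k ∧ l' = l ∧ s + (m - q) = 0 then 1 else 0 := by rw [h₂]; abel
  rw [normalTerm_eq, sub_mul, mul_sub, mul_assoc, h₃, mul_sub, ← mul_assoc, h₁, mul_assoc,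
    Algebra.commutes]
  split_ifs <;> grind

theorem normalTerm_mul_aStar (r : ℕ) (k l k' l' : Fin n) (m q s : ℤ) :
    normalTerm r k l m q * aStar n r k' l' s = aStar n r k' l' s * normalTerm r k l m q +
      if q = -s then (if k = k' ∧ l = l' then aStar n r k l (m + s) else 0) else 0 := by
  have h₁ := (aStar_commute r k l k' l' (m - q) s).eq
  have h₂ := aOp_mul_aStar r k l k' l' q s
  rw [normalTerm_eq, sub_mul, mul_sub, mul_assoc, h₁, ← mul_assoc, h₂, add_mul, mul_assoc,
    Algebra.commutes]
  split_ifs <;> grind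

theorem mulX_eq_aOp_or_aStar (r : ℕ) (k l : Fin n) (s : ℤ) :
    mulX (k, l, s) = aOp n r k l s ∨ mulX (k, l, s) = aStar n r k l (-s) := by
  rw [aOp_eq, aStar_eq, neg_neg]
  grind

theorem partialX_eq_aOp_or_neg_aStar (r : ℕ) (k l : Fin n) (s : ℤ) :
    partialX (k, l, s) = aOp n r k l s ∨ partialX (k, l, s) = -aStar n r k l (-s) := by
  rw [aOp_eq, aStar_eq, neg_neg]
  grind

theorem normalTerm_apply_C_eq_zero {r : ℕ} {k l : Fin n} {m q : ℤ}
    (h : q ∉ Set.Ico m 0 ∨ r ≤ l) (c : ℂ) : normalTerm r k l m q (C c) = 0 := by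
  rw [Set.mem_Ico] at h
  unfold normalTerm
  split_ifs with hq
  · rw [aOp_eq, if_pos hq, Module.End.mul_apply, partialX_apply, pderiv_C, map_zero]
  · rw [aStar_eq, if_neg (by grind), Module.End.mul_apply, LinearMap.neg_apply, partialX_apply,
      pderiv_C, neg_zero, map_zero]

theorem hasFiniteSupport_normalTerm_apply_of_mul_eq {r : ℕ} {k l : Fin n} {m q₀ : ℤ}
    {D E : Module.End ℂ (Px n)}
    (h : ∀ q, normalTerm r k l m q * D = D * normalTerm r k l m q + if q = q₀ then E else 0)
    {P : Px n} (hP : Function.HasFiniteSupport fun q => normalTerm r k l m q P) :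
    Function.HasFiniteSupport fun q => normalTerm r k l m q (D P) := by
  refine Set.Finite.subset (Set.Finite.union hP (Set.finite_singleton q₀)) fun q hq => ?_
  by_contra hc
  simp only [Set.mem_union, Function.mem_support, ne_eq, Set.mem_singleton_iff, not_or,
    not_not] at hc
  apply hq
  have := LinearMap.congr_fun (h q) P
  rw [if_neg hc.2, add_zero, Module.End.mul_apply, Module.End.mul_apply, hc.1, map_zero] at this
  exact this

theorem hasFiniteSupport_normalTerm_apply (r : ℕ) (k l : Fin n) (m : ℤ) (P : Px n) :
    Function.HasFiniteSupport fun q => normalTerm r k l m q P := by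
  induction P using MvPolynomial.induction_on with
  | C c =>
    refine (Set.finite_Ico m 0).subset fun q hq => ?_
    by_contra hc
    exact hq (normalTerm_apply_C_eq_zero (Or.inl hc) c)
  | add P Q hP hQ =>
    simp only [map_add]
    exact hP.add hQ
  | mul_X P s hP =>
    obtain ⟨k', l', s⟩ := s
    rw [mul_comm, ← mulX_apply]
    obtain h | h := mulX_eq_aOp_or_aStar r k' l' s
    · rw [h]
      exact hasFiniteSupport_normalTerm_apply_of_mul_eq
        (fun q => normalTerm_mul_aOp r k l k' l' m q s) hP
    · rw [h]
      exact hasFiniteSupport_normalTerm_apply_of_mul_eq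
        (fun q => normalTerm_mul_aStar r k l k' l' m q (-s)) hP

/-- The operator `N_{kl,m}` as a linear endomorphism. -/
noncomputable def normalSum (r : ℕ) (k l : Fin n) (m : ℤ) : Module.End ℂ (Px n) where
  toFun P := ∑ᶠ q : ℤ, normalTerm r k l m q P
  map_add' P Q := by
    simp only [map_add]
    exact finsum_add_distrib (hasFiniteSupport_normalTerm_apply r k l m P)
      (hasFiniteSupport_normalTerm_apply r k l m Q)
  map_smul' c P := by
    simp only [map_smul, RingHom.id_apply]
    exact (smul_finsum c _).symm

theorem normalSum_apply (r : ℕ) (k l : Fin n) (m : ℤ) (P : Px n) :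
    normalSum r k l m P = ∑ᶠ q : ℤ, normalTerm r k l m q P := rfl

theorem Nop_eq_normalSum (r : ℕ) (k l : Fin n) (m : ℤ) (P : Px n) :
    Nop n r k l m P = normalSum r k l m P := by
  rw [normalSum_apply]
  refine finsum_congr fun q => ?_
  unfold normalTerm
  split_ifs <;> rfl

theorem normalSum_mul_eq_of_normalTerm_mul_eq {r : ℕ} {k l : Fin n} {m q₀ : ℤ}
    {D E : Module.End ℂ (Px n)}
    (h : ∀ q, normalTerm r k l m q * D = D * normalTerm r k l m q + if q = q₀ then E else 0) :
    normalSum r k l m * D = D * normalSum r k l m + E := by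
  refine LinearMap.ext fun P => ?_
  have hP := hasFiniteSupport_normalTerm_apply r k l m P
  have h' (q : ℤ) : normalTerm r k l m q (D P) =
      D (normalTerm r k l m q P) + if q = q₀ then E P else 0 := by
    have := LinearMap.congr_fun (h q) P
    rw [Module.End.mul_apply, LinearMap.add_apply, Module.End.mul_apply] at this
    rw [this]
    split_ifs <;> rfl
  rw [LinearMap.add_apply, Module.End.mul_apply, Module.End.mul_apply, normalSum_apply,
    normalSum_apply, map_finsum D hP, finsum_congr h', finsum_add_distrib]
  · rw [finsum_eq_single (fun q => if q = q₀ then E P else 0) q₀ fun q hq => if_neg hq, if_pos rfl]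
  · exact hP.subset fun q hq hc => hq (by simp only [hc, map_zero])
  · exact (Set.finite_singleton q₀).subset fun q hq => by_contra fun hc => hq (if_neg hc)

theorem normalSum_mul_aOp (r : ℕ) (k l k' l' : Fin n) (m s : ℤ) :
    normalSum r k l m * aOp n r k' l' s = aOp n r k' l' s * normalSum r k l m +
      if k = k' ∧ l = l' then -aOp n r k l (m + s) else 0 :=
  normalSum_mul_eq_of_normalTerm_mul_eq fun q => normalTerm_mul_aOp r k l k' l' m q s

theorem normalSum_mul_aStar (r : ℕ) (k l k' l' : Fin n) (m s : ℤ) :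
    normalSum r k l m * aStar n r k' l' s = aStar n r k' l' s * normalSum r k l m +
      if k = k' ∧ l = l' then aStar n r k l (m + s) else 0 :=
  normalSum_mul_eq_of_normalTerm_mul_eq fun q => normalTerm_mul_aStar r k l k' l' m q s

theorem commute_commutator {V : Type*} [AddCommGroup V] [Module ℂ V]
    {f g a b c d : Module.End ℂ V} (hfa : f * a = a * f + b) (hga : g * a = a * g + c)
    (hfc : f * c = c * f + d) (hgb : g * b = b * g + d) : Commute (f * g - g * f) a := by
  rw [Commute, SemiconjBy, sub_mul, mul_assoc, mul_assoc, hga, hfa, mul_add, mul_add, hfc, hgb,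
    ← mul_assoc, hfa, ← mul_assoc, hga]
  noncomm_ring

theorem mul_neg_eq_of_mul_eq_add_ite {V : Type*} [AddCommGroup V] [Module ℂ V]
    {f g c : Module.End ℂ V} {q : Prop} [Decidable q]
    (h : f * g = g * f + if q then -c else 0) : f * -g = -g * f + if q then c else 0 := by
  rw [mul_neg, neg_mul, h, neg_add]
  split_ifs <;> simp

theorem commutator_normalSum_commute_aOp (r : ℕ) (k l k' l' k'' l'' : Fin n) (m p s : ℤ) :
    Commute (normalSum r k l m * normalSum r k' l' p - normalSum r k' l' p * normalSum r k l m)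
      (aOp n r k'' l'' s) := by
  refine commute_commutator
    (d := if (k = k'' ∧ l = l'') ∧ k' = k'' ∧ l' = l'' then aOp n r k l (m + p + s) else 0)
    (normalSum_mul_aOp ..) (normalSum_mul_aOp ..) ?_ ?_
  · by_cases h : k' = k'' ∧ l' = l''
    · obtain ⟨rfl, rfl⟩ := h
      have := normalSum_mul_aOp r k l k' l' m (p + s)
      rw [if_pos ⟨rfl, rfl⟩, mul_neg_eq_of_mul_eq_add_ite this, ← add_assoc]
      split_ifs <;> grind
    · rw [if_neg h, if_neg (by tauto), mul_zero, zero_mul, add_zero]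
  · by_cases h : k = k'' ∧ l = l''
    · obtain ⟨rfl, rfl⟩ := h
      have := normalSum_mul_aOp r k' l' k l p (m + s)
      rw [if_pos ⟨rfl, rfl⟩, mul_neg_eq_of_mul_eq_add_ite this, add_left_comm, ← add_assoc]
      split_ifs <;> grind
    · rw [if_neg h, if_neg (by tauto), mul_zero, zero_mul, add_zero]

theorem commutator_normalSum_commute_aStar (r : ℕ) (k l k' l' k'' l'' : Fin n) (m p s : ℤ) :
    Commute (normalSum r k l m * normalSum r k' l' p - normalSum r k' l' p * normalSum r k l m)
      (aStar n r k'' l'' s) := by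
  refine commute_commutator
    (d := if (k = k'' ∧ l = l'') ∧ k' = k'' ∧ l' = l'' then aStar n r k l (m + p + s) else 0)
    (normalSum_mul_aStar ..) (normalSum_mul_aStar ..) ?_ ?_
  · by_cases h : k' = k'' ∧ l' = l''
    · obtain ⟨rfl, rfl⟩ := h
      have := normalSum_mul_aStar r k l k' l' m (p + s)
      rw [if_pos ⟨rfl, rfl⟩, this, ← add_assoc]
      split_ifs <;> grind
    · rw [if_neg h, if_neg (by tauto), mul_zero, zero_mul, add_zero]
  · by_cases h : k = k'' ∧ l = l''
    · obtain ⟨rfl, rfl⟩ := h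
      have := normalSum_mul_aStar r k' l' k l p (m + s)
      rw [if_pos ⟨rfl, rfl⟩, this, add_left_comm, ← add_assoc]
      split_ifs <;> grind
    · rw [if_neg h, if_neg (by tauto), mul_zero, zero_mul, add_zero]

theorem eq_C_of_pderiv_eq_zero {σ : Type*} {P : MvPolynomial σ ℂ} (h : ∀ s, pderiv s P = 0) :
    P = C (constantCoeff P) := by
  classical
  ext d
  rw [coeff_C]
  split_ifs with hd
  · rw [← hd, constantCoeff_eq]
  · obtain ⟨s, hs⟩ := Finsupp.ne_iff.mp (Ne.symm hd)
    have hle : Finsupp.single s 1 ≤ d := by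
      rw [Finsupp.single_le_iff]
      exact Nat.one_le_iff_ne_zero.mpr hs
    have := congrArg (coeff (d - Finsupp.single s 1)) (h s)
    rw [coeff_pderiv, tsub_add_cancel_of_le hle, coeff_zero] at this
    exact (mul_eq_zero.mp this).resolve_right (Nat.cast_add_one_ne_zero _)

theorem eq_smul_one_of_commute {r : ℕ} {T : Module.End ℂ (Px n)}
    (ha : ∀ k l s, Commute T (aOp n r k l s)) (hs : ∀ k l s, Commute T (aStar n r k l s)) :
    T = constantCoeff (T 1) • (1 : Module.End ℂ (Px n)) := by
  have hX (s : XIdx n) (P : Px n) : T (X s * P) = X s * T P := by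
    have : Commute T (mulX s) := by
      obtain h | h := mulX_eq_aOp_or_aStar r s.1 s.2.1 s.2.2
      · exact h ▸ ha _ _ _
      · exact h ▸ hs _ _ _
    exact LinearMap.congr_fun this.eq P
  have hD (s : XIdx n) (P : Px n) : T (pderiv s P) = pderiv s (T P) := by
    have : Commute T (partialX s) := by
      obtain h | h := partialX_eq_aOp_or_neg_aStar r s.1 s.2.1 s.2.2
      · exact h ▸ ha _ _ _
      · exact h ▸ commute_neg_right (hs _ _ _)
    exact LinearMap.congr_fun this.eq P
  have h₁ : T 1 = C (constantCoeff (T 1)) := by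
    refine eq_C_of_pderiv_eq_zero fun s => ?_
    rw [← hD, pderiv_one, map_zero]
  refine LinearMap.ext fun P => ?_
  rw [LinearMap.smul_apply, Module.End.one_apply, smul_eq_C_mul, ← h₁]
  induction P using MvPolynomial.induction_on with
  | C c => rw [← mul_one (C c), ← smul_eq_C_mul, map_smul, mul_smul_comm, mul_one]
  | add P Q hP hQ => rw [map_add, hP, hQ, mul_add]
  | mul_X P s hP => rw [mul_comm, hX, hP, mul_left_comm]

theorem constantCoeff_mulX_apply (s : XIdx n) (P : Px n) : constantCoeff (mulX s P) = 0 := by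
  rw [mulX_apply, map_mul, constantCoeff_X, zero_mul]

theorem constantCoeff_aOp_apply {r : ℕ} {k l : Fin n} {m : ℤ} (h : ¬(0 ≤ m ∧ (l : ℕ) + 1 ≤ r))
    (P : Px n) : constantCoeff (aOp n r k l m P) = 0 := by
  rw [aOp_eq, if_neg h, constantCoeff_mulX_apply]

theorem constantCoeff_aStar_apply {r : ℕ} {k l : Fin n} {m : ℤ} (h : m ≤ 0 ∧ (l : ℕ) + 1 ≤ r)
    (P : Px n) : constantCoeff (aStar n r k l m P) = 0 := by
  rw [aStar_eq, if_pos h, constantCoeff_mulX_apply]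

theorem aOp_apply_one {r : ℕ} {k l : Fin n} {m : ℤ} (h : 0 ≤ m ∧ (l : ℕ) + 1 ≤ r) :
    aOp n r k l m 1 = 0 := by
  rw [aOp_eq, if_pos h, partialX_apply, pderiv_one]

theorem constantCoeff_normalSum_apply {r : ℕ} {k l : Fin n} {m : ℤ} (h : m ≤ 0 ∨ r ≤ l)
    (P : Px n) : constantCoeff (normalSum r k l m P) = 0 := by
  rw [normalSum_apply, map_finsum _ (hasFiniteSupport_normalTerm_apply r k l m P)]
  refine finsum_eq_zero_of_forall_eq_zero fun q => ?_
  unfold normalTerm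
  split_ifs with hq
  · exact constantCoeff_aStar_apply (by grind) _
  · exact constantCoeff_aOp_apply hq _

theorem normalSum_apply_one (r : ℕ) (k l : Fin n) (m : ℤ) :
    normalSum r k l m 1 = if (l : ℕ) + 1 ≤ r then
      ∑ q ∈ Finset.Ico m 0, aOp n r k l q (aStar n r k l (m - q) 1) else 0 := by
  rw [normalSum_apply, ← map_one C]
  split_ifs with hl
  · rw [finsum_eq_sum_of_support_subset (s := Finset.Ico m 0)]
    · refine Finset.sum_congr rfl fun q hq => ?_
      rw [Finset.mem_Ico] at hq
      unfold normalTerm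
      rw [if_neg (by grind)]
      rfl
    · intro q hq
      by_contra hc
      rw [Finset.coe_Ico] at hc
      exact hq (normalTerm_apply_C_eq_zero (Or.inl hc) 1)
  · exact finsum_eq_zero_of_forall_eq_zero fun q =>
      normalTerm_apply_C_eq_zero (Or.inr (by grind)) 1

theorem constantCoeff_normalSum_normalSum_one (r : ℕ) (k l k' l' : Fin n) (m p : ℤ) :
    constantCoeff (normalSum r k l m (normalSum r k' l' p 1)) =
      if (k = k' ∧ l = l') ∧ (l : ℕ) + 1 ≤ r ∧ m + p = 0 ∧ 0 < m then -(m : ℂ) else 0 := by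
  by_cases hm : m ≤ 0 ∨ r ≤ l
  · rw [constantCoeff_normalSum_apply hm, if_neg (by grind)]
  push Not at hm
  rw [normalSum_apply_one r k' l' p]
  by_cases hl' : (l' : ℕ) + 1 ≤ r
  swap
  · rw [if_neg hl', map_zero, map_zero, if_neg (by grind)]
  have hterm (q : ℤ) (hq : q ∈ Finset.Ico p 0) :
      constantCoeff (normalSum r k l m (aOp n r k' l' q (aStar n r k' l' (p - q) 1))) =
        if (k = k' ∧ l = l') ∧ m + p = 0 then -1 else 0 := by
    rw [Finset.mem_Ico] at hq
    have h₁ := LinearMap.congr_fun (normalSum_mul_aOp r k l k' l' m q)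
      (aStar n r k' l' (p - q) 1)
    rw [Module.End.mul_apply, LinearMap.add_apply, Module.End.mul_apply] at h₁
    rw [h₁, map_add, constantCoeff_aOp_apply (by grind), zero_add]
    by_cases hk : k = k' ∧ l = l'
    · obtain ⟨rfl, rfl⟩ := hk
      have h₂ := LinearMap.congr_fun (aOp_mul_aStar r k l k l (m + q) (p - q)) 1
      rw [Module.End.mul_apply, LinearMap.add_apply, Module.End.mul_apply] at h₂
      rw [if_pos ⟨rfl, rfl⟩, LinearMap.neg_apply, h₂, map_neg, map_add,
        constantCoeff_aStar_apply (by grind), zero_add]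
      have : m + q + (p - q) = m + p := by ring
      simp only [this, true_and]
      split_ifs <;> simp
    · rw [if_neg hk, if_neg (by tauto), LinearMap.zero_apply, map_zero]
  rw [if_pos hl', map_sum, map_sum, Finset.sum_congr rfl hterm, Finset.sum_const, Int.card_Ico]
  split_ifs with h₁ h₂ h₂
  · have : (((0 - p).toNat : ℤ) : ℂ) = m := by
      rw [Int.toNat_of_nonneg (by lia)]
      congr 1
      lia
    rw [nsmul_eq_mul, ← this, Int.cast_natCast, mul_neg, mul_one]
  · grind
  · grind
  · simp

theorem commutator_normalSum (r : ℕ) (k l k' l' : Fin n) (m p : ℤ) :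
    normalSum r k l m * normalSum r k' l' p - normalSum r k' l' p * normalSum r k l m =
      (if k = k' ∧ l = l' then if (l : ℕ) + 1 ≤ r ∧ m + p = 0 then -(m : ℂ) else 0 else 0) •
        (1 : Module.End ℂ (Px n)) := by
  rw [eq_smul_one_of_commute (r := r)
    (fun _ _ _ => commutator_normalSum_commute_aOp r k l k' l' _ _ m p _)
    (fun _ _ _ => commutator_normalSum_commute_aStar r k l k' l' _ _ m p _)]
  congr 1
  rw [LinearMap.sub_apply, map_sub, Module.End.mul_apply, Module.End.mul_apply,
    constantCoeff_normalSum_normalSum_one, constantCoeff_normalSum_normalSum_one]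
  by_cases hk : k = k' ∧ l = l'
  swap
  · rw [if_neg (by tauto), if_neg (by grind), if_neg hk, sub_zero]
  by_cases hp : (l : ℕ) + 1 ≤ r ∧ m + p = 0
  swap
  · rw [if_neg (by tauto), if_neg (by grind), if_pos hk, if_neg hp, sub_zero]
  obtain rfl : p = -m := by lia
  obtain ⟨rfl, rfl⟩ := hk
  rcases lt_trichotomy m 0 with h | rfl | h
  · rw [if_neg (by grind), if_pos (by grind), if_pos ⟨rfl, rfl⟩, if_pos hp]
    push_cast
    ring
  · simp
  · rw [if_pos (by grind), if_neg (by grind), if_pos ⟨rfl, rfl⟩, if_pos hp, sub_zero]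

/-- The operator `ℋ_{i,m}` as a linear combination of the operators `N_{kl,m}`. -/
theorem Hcal_eq_sum (r : ℕ) (i : Fin n) (m : ℤ) (P : Px n) :
    Hcal n r i m P = (∑ e : Fin n × Fin n, (if e.1 ≤ e.2 then (pairRoot n i e.1 e.2 : ℂ) else 0) •
      normalSum r e.1 e.2 m) P := by
  rw [LinearMap.sum_apply, Fintype.sum_prod_type]
  refine Finset.sum_congr rfl fun k _ => Finset.sum_congr rfl fun l _ => ?_
  rw [LinearMap.smul_apply, Nop_eq_normalSum, ite_smul, zero_smul]

theorem commutator_sum_smul {V ι : Type*} [AddCommGroup V] [Module ℂ V] [Fintype ι]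
    [DecidableEq ι] (c d w : ι → ℂ) (f g : ι → Module.End ℂ V)
    (h : ∀ x y, f x * g y - g y * f x = (if x = y then w x else 0) • (1 : Module.End ℂ V)) :
    (∑ x, c x • f x) * (∑ y, d y • g y) - (∑ y, d y • g y) * (∑ x, c x • f x) =
      (∑ x, c x * d x * w x) • (1 : Module.End ℂ V) := by
  have hxy (x y : ι) : (c x • f x) * (d y • g y) - (d y • g y) * (c x • f x) =
      (if x = y then c x * d x * w x else 0) • (1 : Module.End ℂ V) := by
    rw [smul_mul_smul_comm, smul_mul_smul_comm, mul_comm (d y), ← smul_sub, h, smul_smul]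
    split_ifs with hxy
    · rw [hxy]
    · rw [mul_zero]
  rw [Finset.sum_mul_sum, Finset.sum_mul_sum, Finset.sum_comm (s := Finset.univ (α := ι))
    (f := fun y x => d y • g y * c x • f x), ← Finset.sum_sub_distrib]
  simp only [← Finset.sum_sub_distrib, hxy, ← Finset.sum_smul, Finset.sum_ite_eq,
    Finset.mem_univ, if_true]

theorem Hcal_commutator_eq_sum (r : ℕ) (i j : Fin n) (m p : ℤ) (P : Px n) :
    Hcal n r i m (Hcal n r j p P) - Hcal n r j p (Hcal n r i m P) =
      ((∑ k : Fin n, ∑ l : Fin n, if k ≤ l ∧ (l : ℕ) + 1 ≤ r then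
        (pairRoot n i k l : ℂ) * pairRoot n j k l else 0) *
          if m + p = 0 then -(m : ℂ) else 0) • P := by
  simp only [Hcal_eq_sum]
  rw [← Module.End.mul_apply, ← Module.End.mul_apply, ← LinearMap.sub_apply,
    commutator_sum_smul _ _
      (fun e => if (e.2 : ℕ) + 1 ≤ r ∧ m + p = 0 then -(m : ℂ) else 0) _ _ fun x y => by
        rw [commutator_normalSum]
        simp only [Prod.ext_iff],
    LinearMap.smul_apply, Module.End.one_apply, Fintype.sum_prod_type, Finset.sum_mul]
  simp only [Finset.sum_mul]
  congr 1
  refine Finset.sum_congr rfl fun k _ => Finset.sum_congr rfl fun l _ => ?_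
  split_ifs <;> grind

/-- The coordinate `δ_{a,i} - δ_{a,i+1}` of `α_i = ε_i - ε_{i+1}`. -/
def rootCoord (i a : ℕ) : ℤ := (if a = i then 1 else 0) - (if a = i + 1 then 1 else 0)

theorem cartan_eq_rootCoord_sub (i s : Fin n) :
    cartan n i s = rootCoord i s - rootCoord i (s + 1) := by
  unfold cartan rootCoord
  grind

theorem pairRoot_eq_rootCoord_sub (i : Fin n) {k l : Fin n} (h : k ≤ l) :
    pairRoot n i k l = rootCoord i k - rootCoord i (l + 1) := by
  have h₁ : pairRoot n i k l =
      ∑ s ∈ Finset.Ico (k : ℕ) (l + 1), (rootCoord i s - rootCoord i (s + 1)) := by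
    unfold pairRoot
    have : Finset.Ico (k : ℕ) (l + 1) = (Finset.Icc k l).map Fin.valEmbedding := by
      rw [Fin.map_valEmbedding_Icc]
      rfl
    rw [this, Finset.sum_map]
    exact Finset.sum_congr rfl fun s _ => cartan_eq_rootCoord_sub i s
  have h₂ : (k : ℕ) ≤ l + 1 := Nat.le_succ_of_le h
  rw [h₁, ← neg_sub (rootCoord i (l + 1)), ← Finset.sum_Ico_sub _ h₂, ← Finset.sum_neg_distrib]
  simp only [neg_sub]

theorem sum_range_sum_range_sub_mul_sub (u v : ℕ → ℤ) (R : ℕ) :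
    ∑ b ∈ Finset.range R, ∑ a ∈ Finset.range b, (u a - u b) * (v a - v b) =
      R * ∑ a ∈ Finset.range R, u a * v a -
        (∑ a ∈ Finset.range R, u a) * ∑ a ∈ Finset.range R, v a := by
  induction R with
  | zero => simp
  | succ R ih =>
    have h : ∑ a ∈ Finset.range R, (u a - u R) * (v a - v R) =
        ∑ a ∈ Finset.range R, u a * v a - u R * ∑ a ∈ Finset.range R, v a -
          (∑ a ∈ Finset.range R, u a) * v R + R * (u R * v R) := by
      simp only [sub_mul, mul_sub, Finset.sum_sub_distrib, Finset.sum_const, Finset.card_range,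
        nsmul_eq_mul, ← Finset.mul_sum, ← Finset.sum_mul]
      ring
    simp only [Finset.sum_range_succ, ih, h]
    push_cast
    ring

theorem sum_range_rootCoord (i r : ℕ) :
    ∑ a ∈ Finset.range (r + 1), rootCoord i a = if i = r then 1 else 0 := by
  simp only [rootCoord, Finset.sum_sub_distrib, Finset.sum_ite_eq', Finset.mem_range]
  grind

theorem sum_range_rootCoord_mul (i j : Fin n) (r : ℕ) :
    ∑ a ∈ Finset.range (r + 1), rootCoord i a * rootCoord j a =
      if r < (i : ℕ) + 1 ∧ r < (j : ℕ) + 1 then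
        if (i : ℕ) = r ∧ (j : ℕ) = r then 1 else 0
      else cartan n i j := by
  have h (a : ℕ) : rootCoord i a * rootCoord j a =
      (if a = i then rootCoord j i else 0) - (if a = i + 1 then rootCoord j (i + 1) else 0) := by
    unfold rootCoord
    grind
  simp only [h, Finset.sum_sub_distrib, Finset.sum_ite_eq', Finset.mem_range]
  unfold rootCoord cartan
  grind

theorem sum_pairRoot_mul_pairRoot {r : ℕ} (hr : r ≤ n) (i j : Fin n) :
    (∑ k : Fin n, ∑ l : Fin n, if k ≤ l ∧ (l : ℕ) + 1 ≤ r then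
      pairRoot n i k l * pairRoot n j k l else 0) =
      (r + 1) * (if r < (i : ℕ) + 1 ∧ r < (j : ℕ) + 1 then
        if (i : ℕ) = r ∧ (j : ℕ) = r then 1 else 0
      else cartan n i j) - (if (i : ℕ) = r then 1 else 0) * (if (j : ℕ) = r then 1 else 0) := by
  have h := sum_range_sum_range_sub_mul_sub (rootCoord i) (rootCoord j) (r + 1)
  rw [sum_range_rootCoord, sum_range_rootCoord, sum_range_rootCoord_mul] at h
  push_cast at h
  rw [← h, Finset.sum_range_succ', Finset.range_zero, Finset.sum_empty, add_zero]
  let F (k l : ℕ) : ℤ := if k ≤ l ∧ l + 1 ≤ r then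
    (rootCoord i k - rootCoord i (l + 1)) * (rootCoord j k - rootCoord j (l + 1)) else 0
  have hF : (∑ k : Fin n, ∑ l : Fin n, if k ≤ l ∧ (l : ℕ) + 1 ≤ r then
      pairRoot n i k l * pairRoot n j k l else 0) = ∑ k : Fin n, ∑ l : Fin n, F k l := by
    refine Finset.sum_congr rfl fun k _ => Finset.sum_congr rfl fun l _ => ?_
    simp only [F, Fin.val_fin_le]
    split_ifs with hkl
    · rw [pairRoot_eq_rootCoord_sub i hkl.1, pairRoot_eq_rootCoord_sub j hkl.1]
    · rfl
  rw [hF, Finset.sum_comm, Fin.sum_univ_eq_sum_range (fun l => ∑ k : Fin n, F k l) n]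
  have hk (l : ℕ) : ∑ k : Fin n, F k l = ∑ k ∈ Finset.range n, F k l :=
    Fin.sum_univ_eq_sum_range (fun k => F k l) n
  simp only [hk]
  rw [← Finset.sum_subset (Finset.range_mono hr)]
  · refine Finset.sum_congr rfl fun l hl => ?_
    rw [Finset.mem_range] at hl
    rw [← Finset.sum_subset (Finset.range_mono (show l + 1 ≤ n by lia))]
    · exact Finset.sum_congr rfl fun k hk => if_pos (by grind)
    · exact fun k _ hk => if_neg (by grind)
  · exact fun l _ hl => Finset.sum_eq_zero fun k _ => if_neg (by grind)

end FockSpace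

/-- `[ℋ_{i,m}, ℋ_{j,p}] = −(α_i|α_j)((1−δ_{i>r}δ_{j>r})(r+1) + (r/2)δ_{i,r+1}δ_{j,r+1}) m δ_{m+p,0} id`. -/
theorem Hcal_Hcal_commutator (n r : ℕ) (hn : 1 ≤ n) (hr : r ≤ n)
    (i j : Fin n) (m p : ℤ) (P : Px n) :
    Hcal n r i m (Hcal n r j p P) - Hcal n r j p (Hcal n r i m P) =
      (-(cartan n i j : ℂ) *
        ((1 - (if r < (i : ℕ) + 1 then 1 else 0) * (if r < (j : ℕ) + 1 then 1 else 0))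
            * ((r : ℂ) + 1)
          + (r : ℂ) / 2 * (if (i : ℕ) = r then 1 else 0) * (if (j : ℕ) = r then 1 else 0))
        * (m : ℂ) * (if m + p = 0 then 1 else 0)) • P := by
  rw [FockSpace.Hcal_commutator_eq_sum]
  congr 1
  have h := congrArg (Int.cast : ℤ → ℂ) (FockSpace.sum_pairRoot_mul_pairRoot hr i j)
  push_cast at h
  rw [h]
  by_cases hij : (i : ℕ) = r ∧ (j : ℕ) = r
  · obtain rfl : i = j := Fin.ext (hij.1.trans hij.2.symm)
    simp only [hij.1, cartan]
    split_ifs <;> push_cast <;> grind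
  · have : (if (i : ℕ) = r then (1 : ℂ) else 0) * (if (j : ℕ) = r then 1 else 0) = 0 := by grind
    rw [mul_assoc ((r : ℂ) / 2), this, mul_zero, add_zero, sub_zero, if_neg hij]
    split_ifs <;> grind
end
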